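/- Let T = (V,E) be a finite rooted tree with n vertices, let 𝓗 be a Polish metric space of diameter at most 1, let b ∈ [0,1), and let ν be a b-Lipschitz 𝓗-valued Markov measure indexed by T. Then for every Borel probability measure μ on 𝓗^V one has d̄(μ,ν) ≤ (Δ/n)·√(D(μ‖ν)/2), where d̄ is the transportation metric induced by the normalized Hamming metric on 𝓗^V, D(μ‖ν) is the relative entropy, and Δ is the ℓ² norm of the descendant generating function of T with parameter b. -/

import Mathlib

open MeasureTheory ProbabilityTheory Filter Topology
open scoped ENNReal NNReal

/-- A rooted tree on vertex type `V`, encoded by its root and parent function: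
every vertex reaches the root by iterating `parent`, and the root is a fixed
point of `parent`. -/
structure ParentTree (V : Type*) where
  root : V
  parent : V → V
  parent_root : parent root = root
  reaches_root : ∀ v : V, ∃ n : ℕ, parent^[n] v = root

namespace ParentTree

variable {V : Type*} (T : ParentTree V)

/-- The depth of a vertex: its graph distance to the root. -/
noncomputable def depth (v : V) : ℕ := sInf {n : ℕ | T.parent^[n] v = T.root}

lemma depth_spec (v : V) : T.parent^[T.depth v] v = T.root :=
  Nat.sInf_mem (T.reaches_root v)

lemma depth_root : T.depth T.root = 0 :=
  Nat.eq_zero_of_le_zero (Nat.sInf_le (by simp))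

lemma depth_parent_le (v : V) : T.depth (T.parent v) ≤ T.depth v := by
  have hspec := T.depth_spec v
  cases h : T.depth v with
  | zero =>
      rw [h] at hspec
      simp only [Function.iterate_zero, id_eq] at hspec
      subst hspec
      simp [T.parent_root, T.depth_root]
  | succ m =>
      rw [h, Function.iterate_succ_apply] at hspec
      exact (Nat.sInf_le hspec).trans (Nat.le_succ m)

/-- `Desc T r v` is the set of descendants of `v` exactly `r` generations below `v`. -/
def Desc (r : ℕ) (v : V) : Set V :=
  {w : V | T.parent^[r] w = v ∧ T.depth w = T.depth v + r}

/-- The set of children of a vertex. -/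
def children (v : V) : Set V := {w : V | w ≠ T.root ∧ T.parent w = v}

/-- The graph distance between two vertices of the tree. -/
noncomputable def tdist (v w : V) : ℕ :=
  sInf {k : ℕ | ∃ n m : ℕ, n + m = k ∧ T.parent^[n] v = T.parent^[m] w}

/-- The descendant generating function `δ(v) = ∑_r |D_r(v)| bʳ`. -/
noncomputable def dgf (b : ℝ) (v : V) : ℝ :=
  ∑' r : ℕ, (Nat.card (T.Desc r v) : ℝ) * b ^ r

/-- `Δ = ‖δ‖_{ℓ²(V)}` for a finite tree. -/
noncomputable def Delta [Fintype V] (b : ℝ) : ℝ :=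
  Real.sqrt (∑ v : V, T.dgf b v ^ 2)

/-- Upper growth rate `limsup_r |D_r(ρ)|^{1/r}`. -/
noncomputable def bargr : ℝ≥0∞ :=
  Filter.atTop.limsup fun r : ℕ => (Nat.card (T.Desc r T.root) : ℝ≥0∞) ^ (1 / (r : ℝ))

/-- Maximum local growth rate `limsup_r max_v |D_r(v)|^{1/r}`. -/
noncomputable def maxgr : ℝ≥0∞ :=
  Filter.atTop.limsup fun r : ℕ => ⨆ v : V, (Nat.card (T.Desc r v) : ℝ≥0∞) ^ (1 / (r : ℝ))

/-- The parent map of the depth-`k` truncation. -/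
noncomputable def truncParent (k : ℕ) (v : {v : V // T.depth v ≤ k}) :
    {v : V // T.depth v ≤ k} :=
  ⟨T.parent v.1, le_trans (T.depth_parent_le v.1) v.2⟩

lemma truncParent_iterate (k n : ℕ) (v : {v : V // T.depth v ≤ k}) :
    ((T.truncParent k)^[n] v).1 = T.parent^[n] v.1 := by
  induction n generalizing v with
  | zero => rfl
  | succ n ih =>
      rw [Function.iterate_succ_apply, Function.iterate_succ_apply]
      exact ih _

/-- The subtree induced by the vertices within distance `k` of the root. -/
noncomputable def trunc (k : ℕ) : ParentTree {v : V // T.depth v ≤ k} where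
  root := ⟨T.root, by simp [T.depth_root]⟩
  parent := T.truncParent k
  parent_root := Subtype.ext T.parent_root
  reaches_root := fun v => by
    obtain ⟨n, hn⟩ := T.reaches_root v.1
    exact ⟨n, Subtype.ext (by rw [truncParent_iterate, hn])⟩

end ParentTree
/-- The transportation cost between two measures relative to a cost function `c`:
the infimum over couplings `γ` of `∫ c dγ`. -/
noncomputable def transportCost {X : Type*} [MeasurableSpace X] (c : X → X → ℝ)
    (μ ν : MeasureTheory.Measure X) : ℝ :=
  sInf {r : ℝ | ∃ γ : MeasureTheory.Measure (X × X),
    γ.map Prod.fst = μ ∧ γ.map Prod.snd = ν ∧ r = ∫ q, c q.1 q.2 ∂γ}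

/-- The normalized Hamming distance on `V → H` induced by the metric of `H`. -/
noncomputable def nhdist {V H : Type*} [Fintype V] [PseudoMetricSpace H] (x y : V → H) : ℝ :=
  (Fintype.card V : ℝ)⁻¹ * ∑ v, dist (x v) (y v)

namespace ParentTree

open Classical in
/-- The broadcast (Markov) measure built up level by level: at step `k+1` all the
coordinates at depth `k+1` are sampled, conditionally independently, from the kernels
applied to the values at their parents. -/
noncomputable def levelMeasure {V : Type*} [Fintype V] (T : ParentTree V)
    {H : Type*} [MeasurableSpace H] (m : MeasureTheory.Measure H)
    (q : V → ProbabilityTheory.Kernel H H) : ℕ → MeasureTheory.Measure (V → H)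
  | 0 => m.map (fun h _ => h)
  | (k+1) => (T.levelMeasure m q k).bind fun x =>
      MeasureTheory.Measure.pi fun v =>
        if T.depth v = k + 1 then (q v) (x (T.parent v)) else MeasureTheory.Measure.dirac (x v)

/-- `ν` is a `b`-Lipschitz `H`-valued Markov measure indexed by `T`: it is the broadcast
model of some root distribution and some Markov kernels, each non-root kernel being
`b`-Lipschitz from `H` to the space of measures with the transportation metric. -/
def IsLipMarkov {V : Type*} [Fintype V] (T : ParentTree V)
    {H : Type*} [MeasurableSpace H] [PseudoMetricSpace H] (b : ℝ)
    (ν : MeasureTheory.Measure (V → H)) : Prop :=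
  ∃ (m : MeasureTheory.Measure H) (q : V → ProbabilityTheory.Kernel H H),
    MeasureTheory.IsProbabilityMeasure m ∧ (∀ v, ProbabilityTheory.IsMarkovKernel (q v)) ∧
    (∀ v, v ≠ T.root → ∀ x y : H, transportCost dist ((q v) x) ((q v) y) ≤ b * dist x y) ∧
    ν = T.levelMeasure m q (Fintype.card V)

end ParentTree
open Classical in
/-- The relative entropy `D(μ‖ν) = ∫ log (dμ/dν) dμ` when `μ ≪ ν` (with value `∞` if the
integral diverges), and `D(μ‖ν) = ∞` otherwise. -/
noncomputable def relEntropy {X : Type*} [MeasurableSpace X]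
    (μ ν : MeasureTheory.Measure X) : ℝ≥0∞ :=
  if μ ≪ ν ∧ MeasureTheory.Integrable (fun x => Real.log ((μ.rnDeriv ν x).toReal)) μ
  then ENNReal.ofReal (∫ x, Real.log ((μ.rnDeriv ν x).toReal) ∂μ)
  else ⊤

/-- Kantorovich duality for probability vectors on a finite set. -/
lemma exists_coupling_matrix_of_dual_bound {ι : Type*} [Fintype ι] [DecidableEq ι]
    {d : ι → ι → ℝ} (d_self : ∀ i, d i i = 0) (d_tri : ∀ i j k, d i k ≤ d i j + d j k)
    {p q : ι → ℝ} (hp0 : ∀ i, 0 ≤ p i) (hq0 : ∀ i, 0 ≤ q i)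
    (hp1 : ∑ i, p i = 1) (hq1 : ∑ i, q i = 1) {K : ℝ}
    (hK : ∀ φ : ι → ℝ, (∀ i j, φ i - φ j ≤ d i j) →
      ∑ i, φ i * p i - ∑ i, φ i * q i ≤ K) :
    ∃ w : ι → ι → ℝ, (∀ i j, 0 ≤ w i j) ∧ (∀ i, ∑ j, w i j = p i) ∧
      (∀ j, ∑ i, w i j = q j) ∧ ∑ i, ∑ j, w i j * d i j ≤ K := by
  have hne : (Finset.univ : Finset ι).Nonempty := by
    rw [Finset.nonempty_iff_ne_empty]
    intro h
    rw [h] at hp1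
    simp at hp1
  let L : (ι × ι → ℝ) →ₗ[ℝ] (ι → ℝ) × (ι → ℝ) × ℝ :=
    { toFun := fun w => (fun i => ∑ j, w (i, j), fun j => ∑ i, w (i, j),
        ∑ i, ∑ j, w (i, j) * d i j)
      map_add' := fun x y => by
        ext <;> simp [Finset.sum_add_distrib, add_mul]
      map_smul' := fun r x => by
        ext <;> simp [Finset.mul_sum, mul_assoc] }
  have hLc : Continuous L := by
    change Continuous fun w : ι × ι → ℝ => ((fun i => ∑ j, w (i, j), fun j => ∑ i, w (i, j),
        ∑ i, ∑ j, w (i, j) * d i j) : (ι → ℝ) × (ι → ℝ) × ℝ)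
    fun_prop
  set A : Set ((ι → ℝ) × (ι → ℝ) × ℝ) := L '' stdSimplex ℝ (ι × ι)
  set B : Set ((ι → ℝ) × (ι → ℝ) × ℝ) := {p} ×ˢ {q} ×ˢ Set.Iic K
  by_cases hdisj : Disjoint B A
  swap
  · obtain ⟨z, hzB, w, hw, rfl⟩ := Set.not_disjoint_iff.1 hdisj
    obtain ⟨h1, h2, h3⟩ := hzB
    exact ⟨fun i j => w (i, j), fun i j => hw.1 _, fun i => congrFun h1 i,
      fun j => congrFun h2 j, h3⟩
  exfalso
  obtain ⟨F, u, v, hFB, huv, hFA⟩ := geometric_hahn_banach_closed_compact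
    ((convex_singleton p).prod ((convex_singleton q).prod (convex_Iic K)))
    (isClosed_singleton.prod (isClosed_singleton.prod isClosed_Iic))
    ((convex_stdSimplex ℝ (ι × ι)).linear_image L)
    ((isCompact_stdSimplex ℝ (ι × ι)).image hLc) hdisj
  set φ : ι → ℝ := fun i => F (Pi.single i 1, 0, 0)
  set ψ : ι → ℝ := fun j => F (0, Pi.single j 1, 0)
  set l : ℝ := F (0, 0, 1)
  have hF : ∀ x y t, F (x, y, t) = ∑ i, φ i * x i + ∑ j, ψ j * y j + l * t := by
    intro x y t
    have hsingle : ∀ i : ι, (fun j => if i = j then (1 : ℝ) else 0) = Pi.single i 1 := by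
      intro i
      ext j
      simp [Pi.single_apply, eq_comm]
    have e1 : F (x, 0, 0) = ∑ i, φ i * x i := by
      have := LinearMap.pi_apply_eq_sum_univ
        ((F : _ →ₗ[ℝ] ℝ).comp (LinearMap.inl ℝ (ι → ℝ) ((ι → ℝ) × ℝ))) x
      simp only [LinearMap.comp_apply, LinearMap.inl_apply] at this
      refine this.trans (Finset.sum_congr rfl fun i _ => ?_)
      rw [smul_eq_mul, mul_comm]
      rw [hsingle]
      rfl
    have e2 : F (0, y, 0) = ∑ i, ψ i * y i := by
      have := LinearMap.pi_apply_eq_sum_univ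
        ((F : _ →ₗ[ℝ] ℝ).comp ((LinearMap.inr ℝ (ι → ℝ) ((ι → ℝ) × ℝ)).comp
          (LinearMap.inl ℝ (ι → ℝ) ℝ))) y
      simp only [LinearMap.comp_apply, LinearMap.inl_apply, LinearMap.inr_apply] at this
      refine this.trans (Finset.sum_congr rfl fun i _ => ?_)
      rw [smul_eq_mul, mul_comm]
      rw [hsingle]
      rfl
    have e3 : F (0, 0, t) = l * t := by
      have := F.map_smul t ((0 : ι → ℝ), (0 : ι → ℝ), (1 : ℝ))
      simp only [Prod.smul_mk, smul_zero, smul_eq_mul, mul_one] at this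
      rw [this, mul_comm]
    rw [← e1, ← e2, ← e3, ← map_add, ← map_add]
    simp
  have hB : ∀ t ≤ K, ∑ i, φ i * p i + ∑ j, ψ j * q j + l * t < u := fun t ht => by
    rw [← hF]
    exact hFB _ ⟨rfl, rfl, ht⟩
  have hA : ∀ i j, v < φ i + ψ j + l * d i j := by
    intro i j
    have := hFA _ ⟨Pi.single (i, j) 1, single_mem_stdSimplex ℝ (i, j), rfl⟩
    have hL : L (Pi.single (i, j) 1) = (Pi.single i 1, Pi.single j 1, d i j) := by
      have : ∀ a b, (Pi.single (i, j) (1 : ℝ) : ι × ι → ℝ) (a, b)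
          = (if a = i then 1 else 0) * (if b = j then 1 else 0) := by
        intro a b
        simp only [Pi.single_apply, Prod.mk.injEq]
        split_ifs <;> simp_all
      ext a <;> simp [L, this, Pi.single_apply]
    rw [hL, hF] at this
    simpa [Pi.single_apply] using this
  have hl : 0 ≤ l := by
    by_contra! hneg
    set P := ∑ i, φ i * p i + ∑ j, ψ j * q j
    have h1 := hB (min K ((u - P) / l)) (min_le_left _ _)
    have h2 : l * ((u - P) / l) = u - P := mul_div_cancel₀ _ hneg.ne
    have h3 := mul_le_mul_of_nonpos_left (min_le_right K ((u - P) / l)) hneg.le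
    linarith
  set η : ι → ℝ := fun i => Finset.univ.inf' hne fun j => ψ j + l * d i j
  have hη : ∀ i k, η i - η k ≤ l * d i k := by
    intro i k
    obtain ⟨j, -, hj⟩ := Finset.exists_mem_eq_inf' hne fun j => ψ j + l * d k j
    have h1 : η i ≤ ψ j + l * d i j := Finset.inf'_le _ (Finset.mem_univ j)
    have h2 : η k = ψ j + l * d k j := hj
    have h3 := mul_le_mul_of_nonneg_left (d_tri i k j) hl
    linarith
  have hηK : ∑ i, η i * p i - ∑ i, η i * q i ≤ l * K := by
    rcases hl.eq_or_lt with hl0 | hl0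
    · have i₀ := hne.choose
      have hc : ∀ i, η i = η i₀ := by
        intro i
        have h1 := hη i i₀
        have h2 := hη i₀ i
        rw [← hl0] at h1 h2
        linarith
      simp only [hc, ← Finset.mul_sum, hp1, hq1, ← hl0]
      simp
    · have := hK (fun i => η i / l) fun i j => by
        rw [← sub_div, div_le_iff₀' hl0]
        exact hη i j
      simp only [div_mul_eq_mul_div, ← Finset.sum_div, ← sub_div] at this
      rwa [div_le_iff₀' hl0] at this
  have h1 : v - ∑ i, φ i * p i ≤ ∑ i, η i * p i := by
    have : ∀ i, (v - φ i) * p i ≤ η i * p i := fun i => by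
      refine mul_le_mul_of_nonneg_right ?_ (hp0 i)
      refine Finset.le_inf' _ _ fun j _ => ?_
      linarith [hA i j]
    have := Finset.sum_le_sum fun i (_ : i ∈ Finset.univ) => this i
    simpa [sub_mul, Finset.sum_sub_distrib, ← Finset.mul_sum, hp1] using this
  have h2 : ∑ i, η i * q i ≤ ∑ i, ψ i * q i := by
    refine Finset.sum_le_sum fun i _ => mul_le_mul_of_nonneg_right ?_ (hq0 i)
    have : η i ≤ ψ i + l * d i i := Finset.inf'_le _ (Finset.mem_univ i)
    simpa [d_self] using this
  linarith [hB K le_rfl]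

lemma cost_nonneg {X : Type*} {c : X → X → ℝ} (c_self : ∀ x, c x x = 0)
    (c_symm : ∀ x y, c x y = c y x) (c_tri : ∀ x y z, c x z ≤ c x y + c y z) (x y : X) :
    0 ≤ c x y := by
  linarith [c_tri x y x, c_self x, c_symm x y]

lemma continuous_of_sub_le_cost {X : Type*} [TopologicalSpace X] {c : X → X → ℝ}
    (c_cont : Continuous (Function.uncurry c)) (c_self : ∀ x, c x x = 0)
    {f : X → ℝ} (hf : ∀ x y, f x - f y ≤ c x y) (c_symm : ∀ x y, c x y = c y x) :
    Continuous f := by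
  rw [continuous_iff_continuousAt]
  intro x
  have h : Tendsto (fun y => c y x) (𝓝 x) (𝓝 0) := by
    have : Continuous fun y => c y x := c_cont.comp (by fun_prop : Continuous fun y => (y, x))
    simpa [c_self] using this.tendsto x
  refine tendsto_iff_dist_tendsto_zero.2 (squeeze_zero (fun _ => dist_nonneg) (fun y => ?_) h)
  rw [Real.dist_eq, abs_le]
  constructor
  · linarith [hf x y, c_symm x y]
  · exact hf y x

/-- The coupling with prescribed masses `w i j` on the cells of a finite measurable partition,
conditionally a product on each cell. -/
lemma exists_coupling_of_coupling_matrix {X ι : Type*} [MeasurableSpace X] [Fintype ι]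
    [DecidableEq ι] [MeasurableSpace ι] [MeasurableSingletonClass ι] {I : X → ι}
    (hI : Measurable I) (μ ν : Measure X) [IsProbabilityMeasure μ] [IsProbabilityMeasure ν]
    {w : ι → ι → ℝ} (hw0 : ∀ i j, 0 ≤ w i j) (hwμ : ∀ i, ∑ j, w i j = μ.real (I ⁻¹' {i}))
    (hwν : ∀ j, ∑ i, w i j = ν.real (I ⁻¹' {j})) :
    ∃ γ : Measure (X × X), γ.map Prod.fst = μ ∧ γ.map Prod.snd = ν ∧
      ∀ i j, γ.real ((fun z => (I z.1, I z.2)) ⁻¹' {(i, j)}) = w i j := by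
  have hIm : ∀ i, MeasurableSet (I ⁻¹' {i}) := fun i => hI (measurableSet_singleton i)
  have hμw : ∀ i j, w i j ≠ 0 → μ (I ⁻¹' {i}) ≠ 0 := by
    intro i j hij h0
    have : μ.real (I ⁻¹' {i}) = 0 := by simp [Measure.real, h0]
    rw [← hwμ i, Finset.sum_eq_zero_iff_of_nonneg fun j _ => hw0 i j] at this
    exact hij (this j (Finset.mem_univ j))
  have hνw : ∀ i j, w i j ≠ 0 → ν (I ⁻¹' {j}) ≠ 0 := by
    intro i j hij h0
    have : ν.real (I ⁻¹' {j}) = 0 := by simp [Measure.real, h0]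
    rw [← hwν j, Finset.sum_eq_zero_iff_of_nonneg fun i _ => hw0 i j] at this
    exact hij (this i (Finset.mem_univ i))
  have hsumμ : ∀ i, ∑ j, ENNReal.ofReal (w i j) = μ (I ⁻¹' {i}) := fun i => by
    rw [← ENNReal.ofReal_sum_of_nonneg fun j _ => hw0 i j, hwμ, ofReal_measureReal]
  have hsumν : ∀ j, ∑ i, ENNReal.ofReal (w i j) = ν (I ⁻¹' {j}) := fun j => by
    rw [← ENNReal.ofReal_sum_of_nonneg fun i _ => hw0 i j, hwν, ofReal_measureReal]
  have hcond : ∀ (ρ : Measure X) [IsProbabilityMeasure ρ] (i a : ι), ρ (I ⁻¹' {i}) ≠ 0 →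
      ρ[|I ⁻¹' {i}] (I ⁻¹' {a}) = if i = a then 1 else 0 := by
    intro ρ _ i a h0
    split_ifs with h
    · rw [← h, cond_apply_self h0 (measure_ne_top _ _)]
    · rw [cond_apply (hIm i), ← Set.preimage_inter]
      simp [h]
  set γ : Measure (X × X) := ∑ i, ∑ j, ENNReal.ofReal (w i j) •
    (μ[|I ⁻¹' {i}]).prod (ν[|I ⁻¹' {j}]) with hγ
  refine ⟨γ, ?_, ?_, fun a b => ?_⟩
  · have : ∀ i j, (ENNReal.ofReal (w i j) • (μ[|I ⁻¹' {i}]).prod (ν[|I ⁻¹' {j}])).map Prod.fst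
        = ENNReal.ofReal (w i j) • μ[|I ⁻¹' {i}] := by
      intro i j
      by_cases h : w i j = 0
      · simp [h]
      have := cond_isProbabilityMeasure (hνw i j h)
      rw [Measure.map_smul, Measure.map_fst_prod, measure_univ, one_smul]
    rw [hγ, Measure.map_finset_sum (by fun_prop)]
    simp_rw [Measure.map_finset_sum (Measurable.aemeasurable measurable_fst), this,
      ← Finset.sum_smul, hsumμ]
    exact sum_meas_smul_cond_fiber hI μ
  · have : ∀ i j, (ENNReal.ofReal (w i j) • (μ[|I ⁻¹' {i}]).prod (ν[|I ⁻¹' {j}])).map Prod.snd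
        = ENNReal.ofReal (w i j) • ν[|I ⁻¹' {j}] := by
      intro i j
      by_cases h : w i j = 0
      · simp [h]
      have := cond_isProbabilityMeasure (hμw i j h)
      rw [Measure.map_smul, Measure.map_snd_prod, measure_univ, one_smul]
    rw [hγ, Measure.map_finset_sum (by fun_prop)]
    simp_rw [Measure.map_finset_sum (Measurable.aemeasurable measurable_snd), this]
    rw [Finset.sum_comm]
    simp_rw [← Finset.sum_smul, hsumν]
    exact sum_meas_smul_cond_fiber hI ν
  · have hpre : (fun z : X × X => (I z.1, I z.2)) ⁻¹' {(a, b)}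
        = (I ⁻¹' {a}) ×ˢ (I ⁻¹' {b}) := by
      ext z
      simp
    have hterm : ∀ i j, ENNReal.ofReal (w i j) *
        (μ[|I ⁻¹' {i}] (I ⁻¹' {a}) * ν[|I ⁻¹' {j}] (I ⁻¹' {b}))
        = if i = a then (if j = b then ENNReal.ofReal (w i j) else 0) else 0 := by
      intro i j
      by_cases h : w i j = 0
      · simp [h]
      rw [hcond μ i a (hμw i j h), hcond ν j b (hνw i j h)]
      split_ifs <;> simp
    rw [hpre, Measure.real, hγ]
    simp only [Measure.coe_finsetSum, Finset.sum_apply, Measure.smul_apply, Measure.prod_prod,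
      smul_eq_mul, hterm]
    simp [hw0]

/-- If all functions that are `1`-Lipschitz for the cost `c` have expectations under `μ` and `ν`
that differ by at most `K`, and `μ` and `ν` are each moved at cost at most `ε` by the
discretization `s ∘ I`, then some coupling of `μ` and `ν` has cost at most `K + 4 * ε`. -/
lemma exists_coupling_of_discretization {X ι : Type*} [TopologicalSpace X]
    [SecondCountableTopology X] [MeasurableSpace X] [BorelSpace X] [Fintype ι]
    [DecidableEq ι] [MeasurableSpace ι] [MeasurableSingletonClass ι] {c : X → X → ℝ}
    (c_cont : Continuous (Function.uncurry c)) (c_self : ∀ x, c x x = 0)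
    (c_symm : ∀ x y, c x y = c y x) (c_tri : ∀ x y z, c x z ≤ c x y + c y z) {C : ℝ}
    (c_le : ∀ x y, c x y ≤ C) (μ ν : Measure X) [IsProbabilityMeasure μ]
    [IsProbabilityMeasure ν] {K ε : ℝ}
    (hK : ∀ f : X → ℝ, (∀ x y, f x - f y ≤ c x y) → ∫ x, f x ∂μ - ∫ x, f x ∂ν ≤ K)
    {I : X → ι} (hI : Measurable I) (s : ι → X)
    (hμ : ∫ x, c x (s (I x)) ∂μ ≤ ε) (hν : ∫ x, c x (s (I x)) ∂ν ≤ ε) :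
    ∃ γ : Measure (X × X), γ.map Prod.fst = μ ∧ γ.map Prod.snd = ν ∧
      ∫ z, c z.1 z.2 ∂γ ≤ K + 4 * ε := by
  have c_nonneg := cost_nonneg c_self c_symm c_tri
  have hIm : ∀ i, MeasurableSet (I ⁻¹' {i}) := fun i => hI (measurableSet_singleton i)
  have hsI : Measurable fun x => s (I x) := (measurable_of_finite s).comp hI
  have hcm : Measurable (Function.uncurry c) := c_cont.measurable
  have herr : Measurable fun x => c x (s (I x)) := hcm.comp (measurable_id.prodMk hsI)
  have hcomp : ∀ {Y : Type _} [MeasurableSpace Y] (ρ : Measure Y) [IsProbabilityMeasure ρ]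
      (u v : Y → X), Measurable u → Measurable v → Integrable (fun y => c (u y) (v y)) ρ := by
    intro Y _ ρ _ u v hu hv
    exact Integrable.of_mem_Icc 0 C (hcm.comp (hu.prodMk hv)).aemeasurable
      (Eventually.of_forall fun y => ⟨c_nonneg _ _, c_le _ _⟩)
  have hcell : ∀ (ρ : Measure X) [IsProbabilityMeasure ρ] (φ : ι → ℝ),
      ∑ i, φ i * ρ.real (I ⁻¹' {i}) = ∫ x, φ (I x) ∂ρ := by
    intro ρ _ φ
    have := Measure.isProbabilityMeasure_map (μ := ρ) hI.aemeasurable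
    rw [← integral_map hI.aemeasurable (measurable_of_finite φ).aestronglyMeasurable,
      integral_fintype (Integrable.of_finite)]
    refine Finset.sum_congr rfl fun i _ => ?_
    rw [Measure.real, Measure.real, Measure.map_apply hI (measurableSet_singleton i), smul_eq_mul,
      mul_comm]
  have hone : ∀ (ρ : Measure X) [IsProbabilityMeasure ρ], ∑ i, ρ.real (I ⁻¹' {i}) = 1 := by
    intro ρ _
    simpa using hcell ρ fun _ => 1
  have hne : (Finset.univ : Finset ι).Nonempty := by
    obtain ⟨x⟩ := μ.nonempty_of_neZero
    exact ⟨I x, Finset.mem_univ _⟩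
  obtain ⟨w, hw0, hwμ, hwν, hwK⟩ := exists_coupling_matrix_of_dual_bound
    (d := fun i j => c (s i) (s j)) (p := fun i => μ.real (I ⁻¹' {i}))
    (q := fun i => ν.real (I ⁻¹' {i})) (K := K + 2 * ε)
    (fun i => c_self _) (fun i j k => c_tri _ _ _) (fun i => measureReal_nonneg)
    (fun i => measureReal_nonneg) (hone μ) (hone ν) (by
      intro φ hφ
      rw [hcell μ, hcell ν]
      set f : X → ℝ := fun x => Finset.univ.inf' hne fun i => φ i + c (s i) x
      have hf : ∀ x y, f x - f y ≤ c x y := by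
        intro x y
        obtain ⟨j, -, hj⟩ := Finset.exists_mem_eq_inf' hne fun i => φ i + c (s i) y
        have h1 : f x ≤ φ j + c (s j) x := Finset.inf'_le _ (Finset.mem_univ j)
        have h2 : f y = φ j + c (s j) y := hj
        linarith [c_tri (s j) y x, c_symm x y]
      have hfs : ∀ j, f (s j) = φ j := by
        intro j
        refine le_antisymm ?_ (Finset.le_inf' _ _ fun i _ => by linarith [hφ j i, c_symm (s i) (s j)])
        have : f (s j) ≤ φ j + c (s j) (s j) := Finset.inf'_le _ (Finset.mem_univ j)
        simpa [c_self] using this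
      have hfc := continuous_of_sub_le_cost c_cont c_self hf c_symm
      have hfi : ∀ (ρ : Measure X) [IsProbabilityMeasure ρ], Integrable f ρ := by
        intro ρ _
        obtain ⟨x₀⟩ := μ.nonempty_of_neZero
        refine Integrable.of_mem_Icc (f x₀ - C) (f x₀ + C) hfc.measurable.aemeasurable
          (Eventually.of_forall fun x => ⟨?_, ?_⟩)
        · linarith [hf x₀ x, c_le x₀ x]
        · linarith [hf x x₀, c_le x x₀]
      have hφi : ∀ (ρ : Measure X) [IsProbabilityMeasure ρ], Integrable (fun x => φ (I x)) ρ := by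
        intro ρ _
        have := Measure.isProbabilityMeasure_map (μ := ρ) hI.aemeasurable
        exact (Integrable.of_finite (f := φ) (μ := ρ.map I)).comp_measurable hI
      have hci : ∀ (ρ : Measure X) [IsProbabilityMeasure ρ],
          Integrable (fun x => c x (s (I x))) ρ := fun ρ _ => hcomp ρ _ _ measurable_id hsI
      have h1 : ∫ x, φ (I x) ∂μ ≤ ∫ x, f x ∂μ + ∫ x, c x (s (I x)) ∂μ := by
        rw [← integral_add (hfi μ) (hci μ)]
        refine integral_mono (hφi μ) ((hfi μ).add (hci μ)) fun x => ?_
        dsimp only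
        rw [← hfs]
        linarith [hf (s (I x)) x, c_symm x (s (I x))]
      have h2 : ∫ x, f x ∂ν ≤ ∫ x, φ (I x) ∂ν + ∫ x, c x (s (I x)) ∂ν := by
        rw [← integral_add (hφi ν) (hci ν)]
        refine integral_mono (hfi ν) ((hφi ν).add (hci ν)) fun x => ?_
        dsimp only
        rw [← hfs (I x)]
        linarith [hf x (s (I x))]
      linarith [hK f hf])
  obtain ⟨γ, hγ1, hγ2, hγw⟩ := exists_coupling_of_coupling_matrix hI μ ν hw0 hwμ hwν
  have : IsProbabilityMeasure γ := by
    have : IsProbabilityMeasure (γ.map Prod.fst) := by rwa [hγ1]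
    exact Measure.isProbabilityMeasure_of_map Prod.fst
  refine ⟨γ, hγ1, hγ2, ?_⟩
  have hm1 : Measurable fun z : X × X => s (I z.1) := hsI.comp measurable_fst
  have hm2 : Measurable fun z : X × X => s (I z.2) := hsI.comp measurable_snd
  have e1 : ∫ z, c z.1 (s (I z.1)) ∂γ = ∫ x, c x (s (I x)) ∂μ := by
    rw [← hγ1, integral_map measurable_fst.aemeasurable herr.aestronglyMeasurable]
  have e2 : ∫ z, c z.2 (s (I z.2)) ∂γ = ∫ x, c x (s (I x)) ∂ν := by
    rw [← hγ2, integral_map measurable_snd.aemeasurable herr.aestronglyMeasurable]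
  have e3 : ∫ z, c (s (I z.1)) (s (I z.2)) ∂γ = ∑ i, ∑ j, w i j * c (s i) (s j) := by
    have hII : Measurable fun z : X × X => (I z.1, I z.2) := by fun_prop
    have := Measure.isProbabilityMeasure_map (μ := γ) hII.aemeasurable
    have h := integral_map hII.aemeasurable
      (measurable_of_finite fun a : ι × ι => c (s a.1) (s a.2)).aestronglyMeasurable (μ := γ)
    rw [← h, integral_fintype Integrable.of_finite, Fintype.sum_prod_type]
    refine Finset.sum_congr rfl fun i _ => Finset.sum_congr rfl fun j _ => ?_
    rw [← hγw, Measure.real, Measure.real, Measure.map_apply hII (measurableSet_singleton _),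
      smul_eq_mul]
  have i1 := hcomp γ _ _ measurable_fst hm1
  have i2 := hcomp γ _ _ hm1 hm2
  have i3 := hcomp γ _ _ measurable_snd hm2
  calc ∫ z, c z.1 z.2 ∂γ
      ≤ ∫ z, (c z.1 (s (I z.1)) + c (s (I z.1)) (s (I z.2)) + c z.2 (s (I z.2))) ∂γ := by
        refine integral_mono (hcomp γ _ _ measurable_fst measurable_snd) ((i1.add i2).add i3)
          fun z => ?_
        dsimp only
        linarith [c_tri z.1 (s (I z.1)) z.2, c_tri (s (I z.1)) (s (I z.2)) z.2,
          c_symm z.2 (s (I z.2))]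
    _ = ∫ x, c x (s (I x)) ∂μ + ∑ i, ∑ j, w i j * c (s i) (s j) + ∫ x, c x (s (I x)) ∂ν := by
        rw [← e1, ← e2, ← e3, ← integral_add i1 i2]
        exact integral_add (i1.add i2) i3
    _ ≤ K + 4 * ε := by linarith

/-- Kantorovich duality for a bounded continuous cost satisfying the triangle inequality. -/
lemma transportCost_le_of_dual_bound {X : Type*} [MetricSpace X]
    [TopologicalSpace.SeparableSpace X] [MeasurableSpace X] [BorelSpace X] {c : X → X → ℝ}
    (c_cont : Continuous (Function.uncurry c)) (c_self : ∀ x, c x x = 0)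
    (c_symm : ∀ x y, c x y = c y x) (c_tri : ∀ x y z, c x z ≤ c x y + c y z) {C : ℝ}
    (c_le : ∀ x y, c x y ≤ C) (μ ν : Measure X) [IsProbabilityMeasure μ]
    [IsProbabilityMeasure ν] {K : ℝ}
    (hK : ∀ f : X → ℝ, (∀ x y, f x - f y ≤ c x y) → ∫ x, f x ∂μ - ∫ x, f x ∂ν ≤ K) :
    transportCost c μ ν ≤ K := by
  have := UniformSpace.secondCountable_of_separable X
  have c_nonneg := cost_nonneg c_self c_symm c_tri
  have hcm : Measurable (Function.uncurry c) := c_cont.measurable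
  have := μ.nonempty_of_neZero
  refine le_of_forall_pos_le_add fun ε hε => ?_
  set e := TopologicalSpace.denseSeq X
  have hlim : ∀ (ρ : Measure X) [IsProbabilityMeasure ρ],
      Tendsto (fun N => ∫ x, c x (SimpleFunc.nearestPt e N x) ∂ρ) atTop (𝓝 0) := by
    intro ρ _
    have h0 : (0 : ℝ) = ∫ x, (0 : ℝ) ∂ρ := by simp
    rw [h0]
    refine tendsto_integral_of_dominated_convergence (fun _ => C) (fun N => ?_)
      (integrable_const C) (fun N => Eventually.of_forall fun x => ?_)
      (Eventually.of_forall fun x => ?_)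
    · exact (hcm.comp (measurable_id.prodMk
        (SimpleFunc.nearestPt e N).measurable)).aestronglyMeasurable
    · rw [Real.norm_of_nonneg (c_nonneg _ _)]
      exact c_le _ _
    · have h1 : Continuous fun y => c x y :=
        c_cont.comp (by fun_prop : Continuous fun y => (x, y))
      have h2 := (h1.tendsto x).comp
        (SimpleFunc.tendsto_nearestPt ((TopologicalSpace.denseRange_denseSeq X) x))
      simpa [c_self, Function.comp_def] using h2
  have hev := ((hlim μ).eventually_le_const (by positivity : 0 < ε / 4)).and
    ((hlim ν).eventually_le_const (by positivity : 0 < ε / 4))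
  obtain ⟨N, hNμ, hNν⟩ := hev.exists
  let I : X → Fin (N + 1) := fun x =>
    ⟨SimpleFunc.nearestPtInd e N x, Nat.lt_succ_of_le (SimpleFunc.nearestPtInd_le e N x)⟩
  have hI : Measurable I := by
    refine measurable_to_countable' fun i => ?_
    have : I ⁻¹' {i} = SimpleFunc.nearestPtInd e N ⁻¹' {(i : ℕ)} := by
      ext x
      simp [I, Fin.ext_iff]
    rw [this]
    exact (SimpleFunc.nearestPtInd e N).measurableSet_preimage _
  obtain ⟨γ, h1, h2, h3⟩ := exists_coupling_of_discretization c_cont c_self c_symm c_tri c_le μ ν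
    hK hI (fun i => e i) hNμ hNν
  have hbdd : BddBelow {r : ℝ | ∃ γ : Measure (X × X),
      γ.map Prod.fst = μ ∧ γ.map Prod.snd = ν ∧ r = ∫ q, c q.1 q.2 ∂γ} := by
    refine ⟨0, ?_⟩
    rintro r ⟨γ, -, -, rfl⟩
    exact integral_nonneg fun z => c_nonneg _ _
  refine (csInf_le hbdd ⟨γ, h1, h2, rfl⟩).trans ?_
  linarith

/-- Sub-Gaussian concentration of `f` under `ν` bounds the discrepancy between the expectations
of `f` under `μ` and `ν` by the relative entropy. -/
lemma integral_sub_integral_le_sqrt_of_subgaussian {X : Type*} [MeasurableSpace X]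
    {μ ν : Measure X} [IsProbabilityMeasure μ] [IsProbabilityMeasure ν] (hμν : μ ≪ ν)
    (hllr : Integrable (llr μ ν) μ) {f : X → ℝ} (hf : Measurable f) {C : ℝ}
    (hC : ∀ x, |f x| ≤ C) {S : ℝ} (hS : 0 < S)
    (hsub : ∀ t > 0, ∫ x, Real.exp (t * f x) ∂ν ≤
      Real.exp (t * ∫ x, f x ∂ν + t ^ 2 * S / 8)) :
    ∫ x, f x ∂μ - ∫ x, f x ∂ν ≤ √(S * ((∫ x, llr μ ν x ∂μ) / 2)) := by
  have hbound : ∀ t > 0, ∀ x, t * f x ∈ Set.Icc (-(t * C)) (t * C) := by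
    intro t ht x
    obtain ⟨h1, h2⟩ := abs_le.1 (hC x)
    constructor <;> nlinarith
  have key : ∀ t > 0, t * (∫ x, f x ∂μ - ∫ x, f x ∂ν) ≤
      ∫ x, llr μ ν x ∂μ + t ^ 2 * S / 8 := by
    intro t ht
    have hfμ : Integrable (fun x => t * f x) μ := Integrable.of_mem_Icc _ _
      (hf.const_mul t).aemeasurable (Eventually.of_forall (hbound t ht))
    have hfν : Integrable (fun x => Real.exp (t * f x)) ν := by
      refine Integrable.of_mem_Icc (Real.exp (-(t * C))) (Real.exp (t * C))
        (hf.const_mul t).exp.aemeasurable (Eventually.of_forall fun x => ?_)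
      exact ⟨Real.exp_le_exp.2 (hbound t ht x).1, Real.exp_le_exp.2 (hbound t ht x).2⟩
    have : IsProbabilityMeasure (ν.tilted fun x => t * f x) := isProbabilityMeasure_tilted hfν
    have h1 := InformationTheory.integral_llr_add_sub_measure_univ_nonneg
      (hμν.trans (absolutelyContinuous_tilted hfν))
      (integrable_llr_tilted_right hμν hfμ hllr hfν)
    rw [integral_llr_tilted_right hμν hfμ hfν hllr, integral_const_mul] at h1
    simp only [probReal_univ] at h1
    have h2 := Real.log_le_log (integral_exp_pos hfν) (hsub t ht)
    rw [Real.log_exp] at h2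
    linarith
  set A := ∫ x, f x ∂μ - ∫ x, f x ∂ν
  rcases le_or_gt A 0 with hA | hA
  · exact hA.trans (Real.sqrt_nonneg _)
  · apply Real.le_sqrt_of_sq_le
    have h := key (4 * A / S) (by positivity)
    have e1 : 4 * A / S * A = 4 * A ^ 2 / S := by ring
    have e2 : (4 * A / S) ^ 2 * S / 8 = 2 * A ^ 2 / S := by
      field_simp
      ring
    rw [e1, e2] at h
    have h' : 2 * A ^ 2 / S ≤ ∫ x, llr μ ν x ∂μ := by
      have : 4 * A ^ 2 / S = 2 * A ^ 2 / S + 2 * A ^ 2 / S := by ring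
      linarith
    rw [div_le_iff₀ hS] at h'
    linarith

/-- Hoeffding's lemma for a function of oscillation at most `c`. -/
lemma integral_exp_le_of_oscillation {X : Type*} [MeasurableSpace X] (ρ : Measure X)
    [IsProbabilityMeasure ρ] {g : X → ℝ} (hg : Measurable g) {c : ℝ}
    (hc : ∀ x y, g x - g y ≤ c) :
    ∫ x, Real.exp (g x) ∂ρ ≤ Real.exp (∫ x, g x ∂ρ + c ^ 2 / 8) := by
  obtain ⟨x₀⟩ := ρ.nonempty_of_neZero
  have hne : Nonempty X := ⟨x₀⟩
  have hc0 : 0 ≤ c := by simpa using hc x₀ x₀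
  have hbdd : BddBelow (Set.range g) := by
    refine ⟨g x₀ - c, ?_⟩
    rintro _ ⟨x, rfl⟩
    linarith [hc x₀ x]
  set a := ⨅ x, g x
  have hIcc : ∀ x, g x ∈ Set.Icc a (a + c) := by
    intro x
    refine ⟨ciInf_le hbdd x, ?_⟩
    have : g x - c ≤ a := le_ciInf fun y => by linarith [hc x y]
    linarith
  have h := (hasSubgaussianMGF_of_mem_Icc (μ := ρ) hg.aemeasurable
    (Eventually.of_forall hIcc)).mgf_le 1
  simp only [mgf, one_mul, Real.exp_sub, integral_div] at h
  rw [div_le_iff₀ (Real.exp_pos _), ← Real.exp_add] at h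
  refine h.trans (Real.exp_le_exp.2 (le_of_eq ?_))
  simp [abs_of_nonneg hc0]
  ring

/-- `f` is Lipschitz with respect to the Hamming metric with weights `c`. -/
def WeightedLipschitz {ι H : Type*} [Fintype ι] [PseudoMetricSpace H] (c : ι → ℝ)
    (f : (ι → H) → ℝ) : Prop :=
  ∀ x y, f x - f y ≤ ∑ i, c i * dist (x i) (y i)

namespace WeightedLipschitz

variable {ι H : Type*} [Fintype ι] [PseudoMetricSpace H] {c : ι → ℝ} {f : (ι → H) → ℝ}

lemma continuous (hf : WeightedLipschitz c f) : Continuous f :=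
  continuous_of_sub_le_cost (c := fun (x y : ι → H) => ∑ i, c i * dist (x i) (y i))
    (by unfold Function.uncurry; fun_prop) (by simp) hf (by simp [dist_comm])

lemma sub_le_sum (hf : WeightedLipschitz c f) (hc : ∀ i, 0 ≤ c i)
    (hdist : ∀ x y : H, dist x y ≤ 1) (x y : ι → H) : f x - f y ≤ ∑ i, c i :=
  (hf x y).trans (Finset.sum_le_sum fun i _ => mul_le_of_le_one_right (hc i) (hdist _ _))

lemma exists_abs_le (hf : WeightedLipschitz c f) (hc : ∀ i, 0 ≤ c i)
    (hdist : ∀ x y : H, dist x y ≤ 1) : ∃ C, ∀ x, |f x| ≤ C := by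
  rcases isEmpty_or_nonempty (ι → H) with h | ⟨⟨x₀⟩⟩
  · exact ⟨0, fun x => h.elim x⟩
  refine ⟨|f x₀| + ∑ i, c i, fun x => ?_⟩
  have h1 := hf.sub_le_sum hc hdist x x₀
  have h2 := hf.sub_le_sum hc hdist x₀ x
  rw [abs_le]
  constructor <;> linarith [le_abs_self (f x₀), neg_abs_le (f x₀)]

variable [SecondCountableTopology H] [MeasurableSpace H] [BorelSpace H]

lemma measurable (hf : WeightedLipschitz c f) : Measurable f := hf.continuous.measurable

lemma integrable_comp (hf : WeightedLipschitz c f) (hc : ∀ i, 0 ≤ c i)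
    (hdist : ∀ x y : H, dist x y ≤ 1) {Y : Type*} [MeasurableSpace Y] (ρ : Measure Y)
    [IsProbabilityMeasure ρ] {u : Y → ι → H} (hu : Measurable u) :
    Integrable (fun y => f (u y)) ρ := by
  obtain ⟨C, hC⟩ := hf.exists_abs_le hc hdist
  exact Integrable.of_bound (hf.measurable.comp hu).aestronglyMeasurable C
    (Eventually.of_forall fun y => hC _)

lemma integrable_exp_comp (hf : WeightedLipschitz c f) (hc : ∀ i, 0 ≤ c i)
    (hdist : ∀ x y : H, dist x y ≤ 1) {Y : Type*} [MeasurableSpace Y] (ρ : Measure Y)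
    [IsProbabilityMeasure ρ] {u : Y → ι → H} (hu : Measurable u) :
    Integrable (fun y => Real.exp (f (u y))) ρ := by
  obtain ⟨C, hC⟩ := hf.exists_abs_le hc hdist
  refine Integrable.of_bound (hf.measurable.comp hu).exp.aestronglyMeasurable (Real.exp C)
    (Eventually.of_forall fun y => ?_)
  rw [Real.norm_of_nonneg (Real.exp_pos _).le]
  exact Real.exp_le_exp.2 ((le_abs_self _).trans (hC _))

end WeightedLipschitz

/-- McDiarmid's moment generating function bound for product measures over `Fin n`. -/
lemma integral_exp_pi_fin_le {H : Type*} [PseudoMetricSpace H] [SecondCountableTopology H]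
    [MeasurableSpace H] [BorelSpace H] (hdist : ∀ x y : H, dist x y ≤ 1) (n : ℕ)
    (ρ : Fin n → Measure H) [∀ i, IsProbabilityMeasure (ρ i)] {c : Fin n → ℝ}
    (hc : ∀ i, 0 ≤ c i) {f : (Fin n → H) → ℝ} (hf : WeightedLipschitz c f) :
    ∫ x, Real.exp (f x) ∂(Measure.pi ρ) ≤
      Real.exp (∫ x, f x ∂(Measure.pi ρ) + (∑ i, c i ^ 2) / 8) := by
  induction n with
  | zero =>
    have : f = fun _ => f default := funext fun x => congrArg f (Subsingleton.elim _ _)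
    rw [this]
    simp
  | succ n ih =>
    set ρ' : Fin n → Measure H := fun i => ρ i.succ
    have hmp : MeasurePreserving (fun z : H × (Fin n → H) => (Fin.cons z.1 z.2 : Fin (n + 1) → H))
        ((ρ 0).prod (Measure.pi ρ')) (Measure.pi ρ) := by
      convert (measurePreserving_piFinSuccAbove ρ 0).symm using 1
      · funext z
        simp [MeasurableEquiv.piFinSuccAbove_symm_apply, Fin.consEquiv]
      · simp [ρ']
    have hcons : Measurable fun z : H × (Fin n → H) => (Fin.cons z.1 z.2 : Fin (n + 1) → H) :=
      hmp.measurable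
    have hcomp1 := hf.integrable_comp hc hdist ((ρ 0).prod (Measure.pi ρ')) hcons
    have hcomp2 := hf.integrable_exp_comp hc hdist ((ρ 0).prod (Measure.pi ρ')) hcons
    have e1 : ∫ x, f x ∂(Measure.pi ρ) =
        ∫ a, ∫ z, f (Fin.cons a z) ∂(Measure.pi ρ') ∂(ρ 0) := by
      rw [← hmp.map_eq, integral_map hcons.aemeasurable hf.measurable.aestronglyMeasurable,
        integral_prod _ hcomp1]
    have e2 : ∫ x, Real.exp (f x) ∂(Measure.pi ρ) =
        ∫ a, ∫ z, Real.exp (f (Fin.cons a z)) ∂(Measure.pi ρ') ∂(ρ 0) := by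
      rw [← hmp.map_eq, integral_map hcons.aemeasurable hf.measurable.exp.aestronglyMeasurable,
        integral_prod _ hcomp2]
    have hsec : ∀ a : H, WeightedLipschitz (fun i : Fin n => c i.succ)
        fun z => f (Fin.cons a z) := by
      intro a x y
      simpa [Fin.sum_univ_succ] using hf (Fin.cons a x) (Fin.cons a y)
    have hci : ∀ a : H, Measurable fun z : Fin n → H => (Fin.cons a z : Fin (n + 1) → H) :=
      fun a => hcons.comp measurable_prodMk_left
    set g : H → ℝ := fun a => ∫ z, f (Fin.cons a z) ∂(Measure.pi ρ')
    have hgosc : ∀ a a', g a - g a' ≤ c 0 * dist a a' := by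
      intro a a'
      have i1 := hf.integrable_comp hc hdist (Measure.pi ρ') (hci a)
      have i2 := hf.integrable_comp hc hdist (Measure.pi ρ') (hci a')
      rw [← integral_sub i1 i2]
      refine (integral_mono (i1.sub i2) (integrable_const (c 0 * dist a a')) fun z => ?_).trans
        (by simp)
      simpa [Fin.sum_univ_succ] using hf (Fin.cons a z) (Fin.cons a' z)
    have hgm : Measurable g := by
      refine (continuous_of_sub_le_cost (c := fun a a' => c 0 * dist a a') ?_ (by simp) hgosc
        (by simp [dist_comm])).measurable
      unfold Function.uncurry
      fun_prop
    have hg := integral_exp_le_of_oscillation (ρ 0) hgm (c := c 0) fun a a' =>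
      (hgosc a a').trans (mul_le_of_le_one_right (hc 0) (hdist _ _))
    rw [e1, e2]
    calc ∫ a, ∫ z, Real.exp (f (Fin.cons a z)) ∂(Measure.pi ρ') ∂(ρ 0)
        ≤ ∫ a, Real.exp (g a) * Real.exp ((∑ i : Fin n, c i.succ ^ 2) / 8) ∂(ρ 0) := by
          refine integral_mono hcomp2.integral_prod_left ?_ fun a => ?_
          · have : WeightedLipschitz (fun _ : Unit => c 0) fun x => g (x ()) := by
              intro x y
              simpa using hgosc (x ()) (y ())
            exact (this.integrable_exp_comp (fun _ => hc 0) hdist (ρ 0)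
              (u := fun a _ => a) (by fun_prop)).mul_const _
          · dsimp only
            rw [← Real.exp_add]
            exact ih ρ' (fun i => hc i.succ) (hsec a)
      _ ≤ Real.exp (∫ a, g a ∂(ρ 0) + c 0 ^ 2 / 8) *
          Real.exp ((∑ i : Fin n, c i.succ ^ 2) / 8) := by
          rw [integral_mul_const]
          gcongr
      _ = _ := by
          rw [← Real.exp_add, Fin.sum_univ_succ]
          ring_nf

/-- McDiarmid's moment generating function bound for product measures. -/
lemma integral_exp_pi_le {ι H : Type*} [Fintype ι] [PseudoMetricSpace H]
    [SecondCountableTopology H] [MeasurableSpace H] [BorelSpace H]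
    (hdist : ∀ x y : H, dist x y ≤ 1) (ρ : ι → Measure H) [∀ i, IsProbabilityMeasure (ρ i)]
    {c : ι → ℝ} (hc : ∀ i, 0 ≤ c i) {f : (ι → H) → ℝ} (hf : WeightedLipschitz c f) :
    ∫ x, Real.exp (f x) ∂(Measure.pi ρ) ≤
      Real.exp (∫ x, f x ∂(Measure.pi ρ) + (∑ i, c i ^ 2) / 8) := by
  set e := (Fintype.equivFin ι).symm
  have hmp := measurePreserving_piCongrLeft ρ e
  have h := integral_exp_pi_fin_le hdist _ (fun i => ρ (e i)) (fun i => hc (e i))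
    (f := fun z => f (MeasurableEquiv.piCongrLeft (fun _ => H) e z)) (by
      intro x y
      refine (hf _ _).trans (le_of_eq ?_)
      rw [← e.sum_comp]
      simp only [MeasurableEquiv.coe_piCongrLeft, Equiv.piCongrLeft_apply_apply])
  rw [e.sum_comp fun i => c i ^ 2, hmp.integral_comp' fun x => Real.exp (f x),
    hmp.integral_comp' f] at h
  exact h

lemma transportCost_dist_dirac_le {H : Type*} [PseudoMetricSpace H] [SecondCountableTopology H]
    [MeasurableSpace H] [BorelSpace H] (a b : H) :
    transportCost dist (Measure.dirac a) (Measure.dirac b) ≤ dist a b := by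
  refine csInf_le ⟨0, ?_⟩
    ⟨Measure.dirac (a, b), by simp [Measure.map_dirac' measurable_fst],
      by simp [Measure.map_dirac' measurable_snd], ?_⟩
  · rintro _ ⟨γ, -, -, rfl⟩
    exact integral_nonneg fun q => dist_nonneg
  rw [integral_dirac' (fun q : H × H => dist q.1 q.2) (a, b)
    (continuous_dist.measurable.stronglyMeasurable)]

lemma exists_coupling_lt_of_transportCost_lt {X : Type*} [MeasurableSpace X] {c : X → X → ℝ}
    {μ ν : Measure X} [IsProbabilityMeasure μ] [IsProbabilityMeasure ν] {r : ℝ}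
    (h : transportCost c μ ν < r) :
    ∃ γ : Measure (X × X), γ.map Prod.fst = μ ∧ γ.map Prod.snd = ν ∧
      ∫ q, c q.1 q.2 ∂γ < r := by
  obtain ⟨_, ⟨γ, h1, h2, rfl⟩, h3⟩ := exists_lt_of_csInf_lt (by
    exact ⟨_, μ.prod ν, by simp [Measure.map_fst_prod], by simp [Measure.map_snd_prod], rfl⟩) h
  exact ⟨γ, h1, h2, h3⟩

/-- The expectation of a weighted Lipschitz function changes by at most the weighted sum of the
transportation distances between the factors of two product measures. -/
lemma WeightedLipschitz.integral_pi_sub_integral_pi_le {ι H : Type*} [Fintype ι]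
    [PseudoMetricSpace H] [SecondCountableTopology H] [MeasurableSpace H] [BorelSpace H]
    (hdist : ∀ x y : H, dist x y ≤ 1) {ρ ρ' : ι → Measure H} [∀ i, IsProbabilityMeasure (ρ i)]
    [∀ i, IsProbabilityMeasure (ρ' i)] {c : ι → ℝ} (hc : ∀ i, 0 ≤ c i) {f : (ι → H) → ℝ}
    (hf : WeightedLipschitz c f) {d : ι → ℝ}
    (hd : ∀ i, transportCost dist (ρ i) (ρ' i) ≤ d i) :
    ∫ x, f x ∂(Measure.pi ρ) - ∫ x, f x ∂(Measure.pi ρ') ≤ ∑ i, c i * d i := by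
  refine le_of_forall_pos_le_add fun ε hε => ?_
  set S := ∑ i, c i
  have hS : 0 ≤ S := Finset.sum_nonneg fun i _ => hc i
  have hη : 0 < ε / (S + 1) := by positivity
  choose γ hγ1 hγ2 hγ using fun i => exists_coupling_lt_of_transportCost_lt
    ((hd i).trans_lt (lt_add_of_pos_right (d i) hη))
  have hprob : ∀ i, IsProbabilityMeasure (γ i) := fun i =>
    ⟨by rw [← Set.preimage_univ (f := Prod.fst), ← Measure.map_apply measurable_fst .univ, hγ1,
      measure_univ]⟩
  have hfst : (Measure.pi γ).map (fun z i => (z i).1) = Measure.pi ρ := by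
    rw [Measure.pi_map_pi fun i => measurable_fst.aemeasurable]
    simp_rw [hγ1]
  have hsnd : (Measure.pi γ).map (fun z i => (z i).2) = Measure.pi ρ' := by
    rw [Measure.pi_map_pi fun i => measurable_snd.aemeasurable]
    simp_rw [hγ2]
  have hm1 : Measurable fun (z : ι → H × H) i => (z i).1 := by fun_prop
  have hm2 : Measurable fun (z : ι → H × H) i => (z i).2 := by fun_prop
  have hdm : Measurable fun q : H × H => dist q.1 q.2 := continuous_dist.measurable
  have hdi : ∀ i, Integrable (fun z : ι → H × H => c i * dist (z i).1 (z i).2)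
      (Measure.pi γ) := fun i => by
    refine (Integrable.of_bound (hdm.comp (measurable_pi_apply i)).aestronglyMeasurable 1
      (Eventually.of_forall fun z => ?_)).const_mul _
    simpa [abs_of_nonneg] using hdist (z i).1 (z i).2
  rw [← hfst, ← hsnd, integral_map hm1.aemeasurable hf.measurable.aestronglyMeasurable,
    integral_map hm2.aemeasurable hf.measurable.aestronglyMeasurable,
    ← integral_sub (hf.integrable_comp hc hdist _ hm1) (hf.integrable_comp hc hdist _ hm2)]
  calc ∫ z, (f (fun i => (z i).1) - f (fun i => (z i).2)) ∂(Measure.pi γ)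
      ≤ ∫ z, ∑ i, c i * dist (z i).1 (z i).2 ∂(Measure.pi γ) :=
        integral_mono ((hf.integrable_comp hc hdist _ hm1).sub
          (hf.integrable_comp hc hdist _ hm2)) (integrable_finsetSum _ fun i _ => hdi i)
          fun z => hf _ _
    _ = ∑ i, c i * ∫ q, dist q.1 q.2 ∂(γ i) := by
        rw [integral_finsetSum _ fun i _ => hdi i]
        refine Finset.sum_congr rfl fun i _ => ?_
        rw [integral_const_mul, ← (measurePreserving_eval γ i).map_eq,
          integral_map (measurable_pi_apply i).aemeasurable hdm.aestronglyMeasurable]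
    _ ≤ ∑ i, c i * (d i + ε / (S + 1)) :=
        Finset.sum_le_sum fun i _ => mul_le_mul_of_nonneg_left (hγ i).le (hc i)
    _ = ∑ i, c i * d i + S * (ε / (S + 1)) := by
        simp_rw [mul_add, Finset.sum_add_distrib, ← Finset.sum_mul, S]
    _ ≤ ∑ i, c i * d i + ε := by
        gcongr
        rw [mul_div_assoc', div_le_iff₀ (by positivity)]
        nlinarith

lemma measurable_measure_pi {X ι : Type*} [Fintype ι] {Y : ι → Type*} [MeasurableSpace X]
    [∀ i, MeasurableSpace (Y i)] {κ : X → ∀ i, Measure (Y i)}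
    [∀ x i, IsProbabilityMeasure (κ x i)] (hκ : ∀ i, Measurable fun x => κ x i) :
    Measurable fun x => Measure.pi (κ x) := by
  refine Measurable.measure_of_isPiSystem_of_isProbabilityMeasure generateFrom_pi.symm
    isPiSystem_pi ?_
  rintro _ ⟨s, hs, rfl⟩
  simp_rw [Measure.pi_pi]
  exact Finset.measurable_prod _ fun i _ =>
    (Measure.measurable_coe (hs i (Set.mem_univ i))).comp (hκ i)

lemma integral_bind_kernel {X Y : Type*} [MeasurableSpace X] [MeasurableSpace Y]
    (ρ : Measure X) (κ : Kernel X Y) {f : Y → ℝ} (hf : Integrable f (ρ.bind κ)) :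
    ∫ y, f y ∂(ρ.bind κ) = ∫ x, ∫ y, f y ∂(κ x) ∂ρ := by
  simpa [Kernel.comp_apply] using
    Kernel.integral_comp (η := κ) (κ := Kernel.const Unit ρ) (a := ()) (f := f)
      (by simpa [Kernel.comp_apply] using hf)

lemma integrable_integral_of_integrable_bind {X Y : Type*} [MeasurableSpace X]
    [MeasurableSpace Y] {ρ : Measure X} {κ : Kernel X Y} {f : Y → ℝ}
    (hf : Integrable f (ρ.bind κ)) : Integrable (fun x => ∫ y, f y ∂(κ x)) ρ := by
  simpa using Integrable.integral_comp (η := κ) (κ := Kernel.const Unit ρ) (a := ()) (f := f)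
    (by simpa [Kernel.comp_apply] using hf)

namespace ParentTree

variable {V : Type*} (T : ParentTree V) {H : Type*} [MeasurableSpace H]
  (q : V → Kernel H H)

open Classical in
/-- The conditional law of the coordinate at `v` after sampling the vertices at depth `k + 1`,
given the configuration `x` of the previous levels. -/
noncomputable def siteLaw (k : ℕ) (x : V → H) (v : V) : Measure H :=
  if T.depth v = k + 1 then (q v) (x (T.parent v)) else Measure.dirac (x v)

instance [∀ v, IsMarkovKernel (q v)] (k : ℕ) (x : V → H) (v : V) :
    IsProbabilityMeasure (T.siteLaw q k x v) := by
  unfold siteLaw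
  split_ifs <;> infer_instance

lemma measurable_siteLaw (k : ℕ) (v : V) : Measurable fun x : V → H => T.siteLaw q k x v := by
  unfold siteLaw
  split_ifs
  · exact (q v).measurable.comp (measurable_pi_apply _)
  · exact Measure.measurable_dirac.comp (measurable_pi_apply _)

lemma transportCost_siteLaw_le [PseudoMetricSpace H]
    [SecondCountableTopology H] [BorelSpace H] {b : ℝ}
    (hq : ∀ v, v ≠ T.root → ∀ x y : H, transportCost dist (q v x) (q v y) ≤ b * dist x y)
    (k : ℕ) (x y : V → H) (v : V) :
    transportCost dist (T.siteLaw q k x v) (T.siteLaw q k y v) ≤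
      if T.depth v = k + 1 then b * dist (x (T.parent v)) (y (T.parent v))
        else dist (x v) (y v) := by
  unfold siteLaw
  split_ifs with h
  · refine hq v ?_ _ _
    rintro rfl
    simp [T.depth_root] at h
  · exact transportCost_dist_dirac_le _ _

variable [Fintype V]

/-- The kernel that samples all the coordinates at depth `k + 1`. -/
noncomputable def stepKernel [∀ v, IsMarkovKernel (q v)] (k : ℕ) : Kernel (V → H) (V → H) where
  toFun x := Measure.pi (T.siteLaw q k x)
  measurable' := measurable_measure_pi (T.measurable_siteLaw q k)

lemma stepKernel_apply [∀ v, IsMarkovKernel (q v)] (k : ℕ) (x : V → H) :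
    T.stepKernel q k x = Measure.pi (T.siteLaw q k x) := rfl

instance [∀ v, IsMarkovKernel (q v)] (k : ℕ) : IsMarkovKernel (T.stepKernel q k) :=
  ⟨fun x => by rw [stepKernel_apply]; infer_instance⟩

lemma levelMeasure_succ [∀ v, IsMarkovKernel (q v)] (m : Measure H) (k : ℕ) :
    T.levelMeasure m q (k + 1) = (T.levelMeasure m q k).bind (T.stepKernel q k) := rfl

lemma isProbabilityMeasure_levelMeasure [∀ v, IsMarkovKernel (q v)] (m : Measure H)
    [IsProbabilityMeasure m] (k : ℕ) : IsProbabilityMeasure (T.levelMeasure m q k) := by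
  induction k with
  | zero => exact Measure.isProbabilityMeasure_map (by fun_prop)
  | succ k ih => rw [levelMeasure_succ]; infer_instance

/-- The moment generating function bound for the fresh randomness of one level. -/
lemma integral_exp_stepKernel_le [MetricSpace H] [SecondCountableTopology H]
    [BorelSpace H] [∀ v, IsMarkovKernel (q v)]
    (hdist : ∀ x y : H, dist x y ≤ 1) (k : ℕ) {c : V → ℝ} (hc : ∀ v, 0 ≤ c v)
    {f : (V → H) → ℝ} (hf : WeightedLipschitz c f) (x : V → H) :
    ∫ z, Real.exp (f z) ∂(T.stepKernel q k x) ≤ Real.exp (∫ z, f z ∂(T.stepKernel q k x) +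
      (∑ v, if T.depth v = k + 1 then c v ^ 2 else 0) / 8) := by
  set u : (V → H) → V → H := fun z v => if T.depth v = k + 1 then z v else x v with hu
  have hae : ∀ᵐ z ∂(T.stepKernel q k x), u z = z := by
    rw [stepKernel_apply]
    simp_rw [funext_iff]
    refine ae_all_iff.2 fun v => ?_
    by_cases h : T.depth v = k + 1
    · simp [hu, h]
    · have hv : ∀ᵐ a ∂(T.siteLaw q k x v), x v = a := by
        rw [siteLaw, if_neg h]
        simp
      filter_upwards [(measurePreserving_eval (T.siteLaw q k x) v).quasiMeasurePreserving.ae hv]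
        with z hz
      simpa [hu, h] using hz
  have hg : WeightedLipschitz (fun v => if T.depth v = k + 1 then c v else 0)
      fun z => f (u z) := by
    intro y z
    refine (hf _ _).trans (Finset.sum_le_sum fun v _ => ?_)
    simp only [hu]
    split_ifs <;> simp
  have h := integral_exp_pi_le hdist (T.siteLaw q k x) (fun v => by
    split_ifs
    exacts [hc v, le_rfl]) hg
  have e1 : ∫ z, f (u z) ∂(T.stepKernel q k x) = ∫ z, f z ∂(T.stepKernel q k x) :=
    integral_congr_ae (hae.mono fun z hz => congrArg f hz)
  have e2 : ∫ z, Real.exp (f (u z)) ∂(T.stepKernel q k x) =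
      ∫ z, Real.exp (f z) ∂(T.stepKernel q k x) :=
    integral_congr_ae (hae.mono fun z hz => congrArg (fun y => Real.exp (f y)) hz)
  rw [← stepKernel_apply, e1, e2] at h
  simpa [ite_pow] using h

end ParentTree

namespace ParentTree

variable {V : Type*} (T : ParentTree V)

lemma eq_root_of_depth_eq_zero {v : V} (h : T.depth v = 0) : v = T.root := by
  simpa [h] using T.depth_spec v

lemma depth_le_depth_iterate_add (r : ℕ) (v : V) : T.depth v ≤ T.depth (T.parent^[r] v) + r := by
  refine Nat.sInf_le ?_
  rw [Set.mem_ofPred_eq, Function.iterate_add_apply, T.depth_spec]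

lemma depth_le_depth_parent_add_one (v : V) : T.depth v ≤ T.depth (T.parent v) + 1 :=
  T.depth_le_depth_iterate_add 1 v

lemma depth_iterate_le_sub {r : ℕ} {v : V} (h : r ≤ T.depth v) :
    T.depth (T.parent^[r] v) ≤ T.depth v - r := by
  refine Nat.sInf_le ?_
  rw [Set.mem_ofPred_eq, ← Function.iterate_add_apply, Nat.sub_add_cancel h, T.depth_spec]

lemma depth_parent_of_depth_eq_succ {v : V} {k : ℕ} (h : T.depth v = k + 1) :
    T.depth (T.parent v) = k := by
  have h1 := T.depth_iterate_le_sub (r := 1) (v := v) (by omega)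
  have h2 := T.depth_le_depth_parent_add_one v
  simp only [Function.iterate_one] at h1
  omega

lemma depth_le_card [Fintype V] (v : V) : T.depth v ≤ Fintype.card V := by
  have hinj : Function.Injective fun i : Fin (T.depth v) => T.parent^[i] v := by
    intro i j hij
    dsimp only at hij
    have h1 := T.depth_le_depth_iterate_add i v
    have h2 := T.depth_le_depth_iterate_add j v
    have h3 := T.depth_iterate_le_sub i.2.le
    have h4 := T.depth_iterate_le_sub j.2.le
    rw [hij] at h1 h3
    ext
    omega
  simpa using Fintype.card_le_of_injective _ hinj

open Classical in
lemma natCard_desc_eq_sum [Fintype V] (r : ℕ) (v : V) :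
    (Nat.card (T.Desc r v) : ℝ) = ∑ w, if w ∈ T.Desc r v then 1 else 0 := by
  rw [Finset.sum_boole, Nat.card_eq_fintype_card, Fintype.card_subtype]

open Classical in
lemma natCard_desc_succ [Fintype V] (r : ℕ) (v : V) :
    (Nat.card (T.Desc (r + 1) v) : ℝ) =
      ∑ u, if T.depth u = T.depth v + 1 ∧ T.parent u = v then (Nat.card (T.Desc r u) : ℝ)
        else 0 := by
  simp_rw [natCard_desc_eq_sum]
  have : ∀ u, (if T.depth u = T.depth v + 1 ∧ T.parent u = v then
      ∑ w, (if w ∈ T.Desc r u then (1 : ℝ) else 0) else 0) =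
      ∑ w, if (T.depth u = T.depth v + 1 ∧ T.parent u = v) ∧ w ∈ T.Desc r u then 1 else 0 := by
    intro u
    split_ifs with h <;> simp [h]
  simp_rw [this]
  rw [Finset.sum_comm]
  refine Finset.sum_congr rfl fun w _ => ?_
  rw [Finset.sum_eq_single (T.parent^[r] w)]
  · congr 1
    have h1 := T.depth_le_depth_iterate_add r w
    have h2 := T.depth_le_depth_parent_add_one (T.parent^[r] w)
    simp only [Desc, Set.mem_ofPred_eq, Function.iterate_succ_apply', eq_iff_iff]
    constructor
    · rintro ⟨rfl, h⟩
      refine ⟨⟨?_, rfl⟩, trivial, ?_⟩ <;> omega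
    · rintro ⟨⟨h3, h4⟩, -, h5⟩
      exact ⟨h4, by omega⟩
  · intro u _ hu
    exact if_neg fun h => hu h.2.1.symm
  · simp

lemma summable_natCard_desc_mul_pow [Fintype V] {b : ℝ} (hb0 : 0 ≤ b) (hb1 : b < 1) (v : V) :
    Summable fun r => (Nat.card (T.Desc r v) : ℝ) * b ^ r := by
  refine Summable.of_nonneg_of_le (fun r => by positivity) (fun r => ?_)
    ((summable_geometric_of_lt_one hb0 hb1).mul_left (Nat.card V : ℝ))
  gcongr
  exact Finite.card_subtype_le _

open Classical in
lemma dgf_eq_one_add_sum [Fintype V] {b : ℝ} (hb0 : 0 ≤ b) (hb1 : b < 1) (v : V) :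
    T.dgf b v = 1 + ∑ u, if T.depth u = T.depth v + 1 ∧ T.parent u = v then b * T.dgf b u
      else 0 := by
  have hzero : (Nat.card (T.Desc 0 v) : ℝ) = 1 := by
    have : T.Desc 0 v = {v} := by
      ext w
      simp +contextual [Desc]
    simp [this]
  rw [dgf, (T.summable_natCard_desc_mul_pow hb0 hb1 v).tsum_eq_zero_add, hzero, pow_zero, one_mul]
  congr 1
  have : ∀ u, (if T.depth u = T.depth v + 1 ∧ T.parent u = v then b * T.dgf b u else 0) =
      ∑' r, (if T.depth u = T.depth v + 1 ∧ T.parent u = v then (Nat.card (T.Desc r u) : ℝ)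
        else 0) * b ^ (r + 1) := by
    intro u
    split_ifs
    · rw [dgf, ← tsum_mul_left]
      exact tsum_congr fun r => by ring
    · simp
  simp_rw [this, natCard_desc_succ, Finset.sum_mul]
  rw [Summable.tsum_finsetSum]
  intro u _
  split_ifs
  · refine ((T.summable_natCard_desc_mul_pow hb0 hb1 u).mul_left b).congr fun r => by ring
  · simp

lemma one_le_dgf [Fintype V] {b : ℝ} (hb0 : 0 ≤ b) (hb1 : b < 1) (v : V) : 1 ≤ T.dgf b v := by
  classical
  rw [dgf_eq_one_add_sum T hb0 hb1, le_add_iff_nonneg_right]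
  refine Finset.sum_nonneg fun u _ => ?_
  split_ifs
  · exact mul_nonneg hb0 (tsum_nonneg fun r => by positivity)
  · exact le_rfl

end ParentTree

namespace ParentTree

variable {V : Type*} (T : ParentTree V)

/-- The Lipschitz weights of the conditional expectation given the levels up to depth `k`
of a function with constant weights `a`. -/
noncomputable def levelWeight (b a : ℝ) (k : ℕ) (v : V) : ℝ :=
  if T.depth v < k then a else if T.depth v = k then a * T.dgf b v else 0

lemma levelWeight_nonneg {b a : ℝ} (hb0 : 0 ≤ b) (ha : 0 ≤ a) (k : ℕ) (v : V) :
    0 ≤ T.levelWeight b a k v := by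
  have : 0 ≤ T.dgf b v := tsum_nonneg fun r => by positivity
  unfold levelWeight
  split_ifs <;> positivity

variable [Fintype V]

lemma le_levelWeight_card {b a : ℝ} (hb0 : 0 ≤ b) (hb1 : b < 1) (ha : 0 ≤ a) (v : V) :
    a ≤ T.levelWeight b a (Fintype.card V) v := by
  have h := T.depth_le_card v
  unfold levelWeight
  split_ifs with h1 h2
  · exact le_rfl
  · exact le_mul_of_one_le_right ha (T.one_le_dgf hb0 hb1 v)
  · omega

open Classical in
lemma levelWeight_eq_add_sum {b a : ℝ} (hb0 : 0 ≤ b) (hb1 : b < 1) (k : ℕ) (w : V) :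
    T.levelWeight b a k w = (if T.depth w ≤ k then a else 0) +
      ∑ v, if T.depth v = k + 1 ∧ T.parent v = w then a * T.dgf b v * b else 0 := by
  unfold levelWeight
  by_cases hw : T.depth w = k
  · rw [if_neg (by omega), if_pos hw, if_pos hw.le, dgf_eq_one_add_sum T hb0 hb1, hw, mul_add,
      mul_one, Finset.mul_sum]
    congr 1
    refine Finset.sum_congr rfl fun v _ => ?_
    split_ifs <;> ring
  · rw [if_neg hw, Finset.sum_eq_zero, add_zero]
    · split_ifs <;> first | rfl | omega
    · rintro v -
      refine if_neg ?_
      rintro ⟨h1, rfl⟩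
      exact hw (T.depth_parent_of_depth_eq_succ h1)

lemma sum_levelWeight_succ_mul {b a : ℝ} (hb0 : 0 ≤ b) (hb1 : b < 1) (k : ℕ) (d : V → ℝ) :
    ∑ v, T.levelWeight b a (k + 1) v *
      (if T.depth v = k + 1 then b * d (T.parent v) else d v) =
      ∑ v, T.levelWeight b a k v * d v := by
  classical
  simp_rw [T.levelWeight_eq_add_sum hb0 hb1 k, add_mul, Finset.sum_mul, Finset.sum_add_distrib]
  rw [Finset.sum_comm, ← Finset.sum_add_distrib]
  refine Finset.sum_congr rfl fun v _ => ?_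
  have : ∀ w, (if T.depth v = k + 1 ∧ T.parent v = w then a * T.dgf b v * b else 0) * d w =
      if T.parent v = w then
        if T.depth v = k + 1 then a * T.dgf b v * b * d w else 0 else 0 := by
    intro w
    split_ifs <;> simp_all
  simp_rw [this]
  rw [Finset.sum_ite_eq, if_pos (Finset.mem_univ _)]
  unfold levelWeight
  split_ifs <;> first | omega | ring

variable {H : Type*} [MetricSpace H] [SecondCountableTopology H] [MeasurableSpace H]
  [BorelSpace H] (q : V → Kernel H H) [∀ v, IsMarkovKernel (q v)]

lemma weightedLipschitz_integral_stepKernel (hdist : ∀ x y : H, dist x y ≤ 1) {b : ℝ}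
    (hb0 : 0 ≤ b) (hb1 : b < 1)
    (hq : ∀ v, v ≠ T.root → ∀ x y : H, transportCost dist (q v x) (q v y) ≤ b * dist x y)
    {a : ℝ} (ha : 0 ≤ a) (k : ℕ) {f : (V → H) → ℝ}
    (hf : WeightedLipschitz (T.levelWeight b a (k + 1)) f) :
    WeightedLipschitz (T.levelWeight b a k) fun x => ∫ z, f z ∂(T.stepKernel q k x) := by
  intro x y
  simp_rw [stepKernel_apply]
  refine (hf.integral_pi_sub_integral_pi_le hdist (T.levelWeight_nonneg hb0 ha _)
    (T.transportCost_siteLaw_le q hq k x y)).trans (le_of_eq ?_)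
  exact T.sum_levelWeight_succ_mul hb0 hb1 k fun v => dist (x v) (y v)

/-- The moment generating function bound for the broadcast model up to depth `k`. -/
lemma integral_exp_levelMeasure_le (hdist : ∀ x y : H, dist x y ≤ 1) {b : ℝ}
    (hb0 : 0 ≤ b) (hb1 : b < 1)
    (hq : ∀ v, v ≠ T.root → ∀ x y : H, transportCost dist (q v x) (q v y) ≤ b * dist x y)
    (m : Measure H) [IsProbabilityMeasure m] {a : ℝ} (ha : 0 ≤ a) (k : ℕ) {f : (V → H) → ℝ}
    (hf : WeightedLipschitz (T.levelWeight b a k) f) :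
    ∫ x, Real.exp (f x) ∂(T.levelMeasure m q k) ≤
      Real.exp (∫ x, f x ∂(T.levelMeasure m q k) +
        (∑ v, if T.depth v ≤ k then (a * T.dgf b v) ^ 2 else 0) / 8) := by
  induction k generalizing f with
  | zero =>
    classical
    have hconst : Measurable fun (h : H) (_ : V) => h := by fun_prop
    have hzero : ∀ v, T.depth v ≤ 0 ↔ T.root = v := fun v =>
      ⟨fun h => (T.eq_root_of_depth_eq_zero (by omega)).symm, fun h => by rw [← h, T.depth_root]⟩
    have hW : ∀ v, T.levelWeight b a 0 v = if T.root = v then a * T.dgf b v else 0 := by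
      intro v
      simp [← hzero, levelWeight]
    rw [levelMeasure, integral_map hconst.aemeasurable hf.measurable.exp.aestronglyMeasurable,
      integral_map hconst.aemeasurable hf.measurable.aestronglyMeasurable]
    simp_rw [hzero, Finset.sum_ite_eq, if_pos (Finset.mem_univ _)]
    refine integral_exp_le_of_oscillation m (hf.measurable.comp hconst) fun x y => ?_
    refine (hf.sub_le_sum (T.levelWeight_nonneg hb0 ha 0) hdist _ _).trans (le_of_eq ?_)
    simp [hW]
  | succ k ih =>
    have hprob := T.isProbabilityMeasure_levelMeasure q m k
    have hprob' := T.isProbabilityMeasure_levelMeasure q m (k + 1)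
    rw [levelMeasure_succ] at hprob' ⊢
    have hW := T.levelWeight_nonneg hb0 ha (k + 1)
    have hP := T.weightedLipschitz_integral_stepKernel q hdist hb0 hb1 hq ha k hf
    have hfi := hf.integrable_comp hW hdist ((T.levelMeasure m q k).bind (T.stepKernel q k))
      measurable_id
    have hefi := hf.integrable_exp_comp hW hdist
      ((T.levelMeasure m q k).bind (T.stepKernel q k)) measurable_id
    dsimp only [id] at hfi hefi
    set s := (∑ v, if T.depth v = k + 1 then T.levelWeight b a (k + 1) v ^ 2 else 0) / 8 with hs
    have hsum : (∑ v, if T.depth v ≤ k + 1 then (a * T.dgf b v) ^ 2 else 0) / 8 =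
        (∑ v, if T.depth v ≤ k then (a * T.dgf b v) ^ 2 else 0) / 8 + s := by
      rw [hs, ← add_div, ← Finset.sum_add_distrib]
      congr 1
      refine Finset.sum_congr rfl fun v _ => ?_
      unfold levelWeight
      split_ifs <;> first | omega | ring
    rw [integral_bind_kernel _ _ hfi, integral_bind_kernel _ _ hefi]
    calc ∫ x, ∫ z, Real.exp (f z) ∂(T.stepKernel q k x) ∂(T.levelMeasure m q k)
        ≤ ∫ x, Real.exp (∫ z, f z ∂(T.stepKernel q k x)) * Real.exp s
            ∂(T.levelMeasure m q k) := by
          refine integral_mono (integrable_integral_of_integrable_bind hefi) ((hP.integrable_exp_comp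
            (T.levelWeight_nonneg hb0 ha k) hdist _ measurable_id).mul_const _) fun x => ?_
          dsimp only
          rw [← Real.exp_add]
          exact T.integral_exp_stepKernel_le q hdist k hW hf x
      _ ≤ Real.exp (∫ x, ∫ z, f z ∂(T.stepKernel q k x) ∂(T.levelMeasure m q k) +
            (∑ v, if T.depth v ≤ k then (a * T.dgf b v) ^ 2 else 0) / 8) * Real.exp s := by
          rw [integral_mul_const]
          gcongr
          exact ih hP
      _ = _ := by
          rw [← Real.exp_add, hsum, add_assoc]

end ParentTree

lemma ParentTree.Delta_sq {V : Type*} [Fintype V] (T : ParentTree V) (b : ℝ) :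
    T.Delta b ^ 2 = ∑ v, T.dgf b v ^ 2 :=
  Real.sq_sqrt (Finset.sum_nonneg fun _ _ => sq_nonneg _)

lemma ParentTree.Delta_pos {V : Type*} [Fintype V] (T : ParentTree V) {b : ℝ} (hb0 : 0 ≤ b) (hb1 : b < 1) :
    0 < T.Delta b := by
  refine Real.sqrt_pos.2 (Finset.sum_pos (fun v _ => ?_) ⟨T.root, Finset.mem_univ _⟩)
  have := T.one_le_dgf hb0 hb1 v
  positivity

/-- Functions that are `1`-Lipschitz for the normalized Hamming metric are sub-Gaussian under a
Lipschitz Markov measure. -/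
lemma integral_exp_le_of_isLipMarkov {V H : Type*} [Fintype V] (T : ParentTree V) [MetricSpace H]
    [SecondCountableTopology H] [MeasurableSpace H] [BorelSpace H]
    (hdist : ∀ x y : H, dist x y ≤ 1) {b : ℝ} (hb0 : 0 ≤ b) (hb1 : b < 1) {ν : Measure (V → H)}
    (hν : T.IsLipMarkov b ν) {f : (V → H) → ℝ} (hf : ∀ x y, f x - f y ≤ nhdist x y) {t : ℝ}
    (ht : 0 < t) :
    ∫ x, Real.exp (t * f x) ∂ν ≤
      Real.exp (t * ∫ x, f x ∂ν + t ^ 2 * (T.Delta b / (Fintype.card V : ℝ)) ^ 2 / 8) := by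
  obtain ⟨m, q, hm, hqm, hq, rfl⟩ := hν
  set n : ℝ := (Fintype.card V : ℝ)
  have ha : 0 ≤ t / n := by positivity
  have hlip : WeightedLipschitz (T.levelWeight b (t / n) (Fintype.card V)) fun x => t * f x := by
    intro x y
    calc t * f x - t * f y = t * (f x - f y) := by ring
      _ ≤ t * nhdist x y := by gcongr; exact hf x y
      _ = ∑ v, t / n * dist (x v) (y v) := by
        rw [nhdist, Finset.mul_sum, Finset.mul_sum]
        exact Finset.sum_congr rfl fun v _ => by ring
      _ ≤ _ := by
        gcongr
        exact T.le_levelWeight_card hb0 hb1 ha _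
  refine (T.integral_exp_levelMeasure_le q hdist hb0 hb1 hq m ha _ hlip).trans_eq ?_
  simp_rw [if_pos (T.depth_le_card _), mul_pow, ← Finset.mul_sum, ← T.Delta_sq, integral_const_mul]
  congr 2
  ring

lemma isProbabilityMeasure_of_isLipMarkov {V H : Type*} [Fintype V] {T : ParentTree V}
    [PseudoMetricSpace H] [MeasurableSpace H] {b : ℝ} {ν : Measure (V → H)}
    (hν : T.IsLipMarkov b ν) : IsProbabilityMeasure ν := by
  obtain ⟨m, q, hm, hqm, -, rfl⟩ := hν
  exact T.isProbabilityMeasure_levelMeasure q m _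

lemma nhdist_le_one {V H : Type*} [Fintype V] [PseudoMetricSpace H]
    (hdist : ∀ x y : H, dist x y ≤ 1) (x y : V → H) : nhdist x y ≤ 1 := by
  refine inv_mul_le_one_of_le₀ ?_ (Nat.cast_nonneg _)
  exact (Finset.sum_le_sum fun v _ => hdist (x v) (y v)).trans (by simp)

/-- The transportation-entropy inequality in the case of finite relative entropy. -/
lemma transportCost_le_of_isLipMarkov {V H : Type*} [Fintype V] (T : ParentTree V) [MetricSpace H]
    [SecondCountableTopology H] [MeasurableSpace H] [BorelSpace H]
    (hdist : ∀ x y : H, dist x y ≤ 1) {b : ℝ} (hb0 : 0 ≤ b) (hb1 : b < 1) {ν : Measure (V → H)}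
    (hν : T.IsLipMarkov b ν) {μ : Measure (V → H)} [IsProbabilityMeasure μ] (hμν : μ ≪ ν)
    (hllr : Integrable (llr μ ν) μ) :
    transportCost nhdist μ ν ≤
      T.Delta b / (Fintype.card V : ℝ) * √((∫ x, llr μ ν x ∂μ) / 2) := by
  have hprob := isProbabilityMeasure_of_isLipMarkov hν
  have hcard : 0 < (Fintype.card V : ℝ) := Nat.cast_pos.2 (Fintype.card_pos_iff.2 ⟨T.root⟩)
  have hΔ : 0 < T.Delta b / (Fintype.card V : ℝ) := div_pos (T.Delta_pos hb0 hb1) hcard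
  have hself : ∀ x : V → H, nhdist x x = 0 := fun x => by simp [nhdist]
  have hsymm : ∀ x y : V → H, nhdist x y = nhdist y x := fun x y => by
    simp [nhdist, dist_comm]
  have hcont : Continuous (Function.uncurry fun x y : V → H => nhdist x y) := by
    unfold Function.uncurry nhdist
    fun_prop
  refine transportCost_le_of_dual_bound (c := nhdist) hcont hself hsymm (fun x y z => ?_)
    (nhdist_le_one hdist) μ ν fun f hf => ?_
  · unfold nhdist
    rw [← mul_add, ← Finset.sum_add_distrib]
    gcongr
    exact dist_triangle _ _ _
  · rw [← Real.sqrt_sq hΔ.le, ← Real.sqrt_mul (sq_nonneg _)]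
    obtain ⟨x₀⟩ := ν.nonempty_of_neZero
    refine integral_sub_integral_le_sqrt_of_subgaussian hμν hllr
      (continuous_of_sub_le_cost hcont hself hf hsymm).measurable (C := |f x₀| + 1) (fun x => ?_)
      (by positivity) fun t ht => integral_exp_le_of_isLipMarkov T hdist hb0 hb1 hν hf ht
    have h1 := (hf x x₀).trans (nhdist_le_one hdist _ _)
    have h2 := (hf x₀ x).trans (nhdist_le_one hdist _ _)
    rw [abs_le]
    constructor <;> linarith [le_abs_self (f x₀), neg_abs_le (f x₀)]

/-- **Theorem (transportation–entropy inequality).** Let `T` be a finite rooted tree with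
`n` vertices, `H` a Polish metric space of diameter at most `1`, `b ∈ [0,1)`, and `ν` a
`b`-Lipschitz `H`-valued Markov measure indexed by `T`. Then for every Borel probability
measure `μ` on `H^V`, `d̄(μ,ν) ≤ (Δ/n)·√(D(μ‖ν)/2)` (an inequality in `[0,∞]`, so that it
is trivial when `D(μ‖ν) = ∞`). -/
theorem markov_transport_entropy
    {V : Type} [Fintype V] (T : ParentTree V)
    {H : Type} [MetricSpace H] [TopologicalSpace.SeparableSpace H] [CompleteSpace H]
    [MeasurableSpace H] [BorelSpace H]
    (hdiam : EMetric.diam (Set.univ : Set H) ≤ 1)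
    {b : ℝ} (hb0 : 0 ≤ b) (hb1 : b < 1)
    (ν : MeasureTheory.Measure (V → H)) (hν : T.IsLipMarkov b ν)
    (μ : MeasureTheory.Measure (V → H)) (hμ : MeasureTheory.IsProbabilityMeasure μ) :
    ENNReal.ofReal (transportCost (fun x y : V → H => nhdist x y) μ ν) ≤
      ENNReal.ofReal (T.Delta b / (Fintype.card V : ℝ)) * (relEntropy μ ν / 2) ^ (1/2 : ℝ) := by
  have : SecondCountableTopology H := UniformSpace.secondCountable_of_separable H
  have hdist : ∀ x y : H, dist x y ≤ 1 := by
    intro x y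
    have h := (Metric.edist_le_ediam_of_mem (Set.mem_univ x) (Set.mem_univ y)).trans hdiam
    rwa [edist_dist, ENNReal.ofReal_le_one] at h
  have hprob := isProbabilityMeasure_of_isLipMarkov hν
  have hcard : 0 < (Fintype.card V : ℝ) := Nat.cast_pos.2 (Fintype.card_pos_iff.2 ⟨T.root⟩)
  have hΔ : 0 < T.Delta b / (Fintype.card V : ℝ) := div_pos (T.Delta_pos hb0 hb1) hcard
  unfold relEntropy
  split_ifs with h
  · obtain ⟨hμν, hllr⟩ := h
    have hD : 0 ≤ ∫ x, llr μ ν x ∂μ := by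
      simpa using InformationTheory.integral_llr_add_sub_measure_univ_nonneg hμν hllr
    refine (ENNReal.ofReal_le_ofReal
      (transportCost_le_of_isLipMarkov T hdist hb0 hb1 hν hμν hllr)).trans_eq ?_
    rw [ENNReal.ofReal_mul hΔ.le, Real.sqrt_eq_rpow,
      ← ENNReal.ofReal_rpow_of_nonneg (by positivity) (by positivity),
      ENNReal.ofReal_div_of_pos two_pos, ENNReal.ofReal_ofNat]
    rfl
  · rw [ENNReal.top_div_of_ne_top ENNReal.ofNat_ne_top, ENNReal.top_rpow_of_pos (by norm_num),
      ENNReal.mul_top (by simpa using hΔ)]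
    exact le_top
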